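/- Let T be a triangulated category, S a thick subcategory with a torsion pair S = X ⊥ Y, and suppose T has torsion pairs T = X ⊥ X^⊥ = ^⊥Y ⊥ Y. Set Z := X^⊥ ∩ ^⊥(Y[1]) and P := X[1] ∩ Y. Then for objects M, N ∈ Z, the natural map Hom_T(M,N)/[P](M,N) → Hom_{T/S}(M,N) induced by the quotient functor is bijective. Consequently the composition Z ⊂ T → T/S induces an equivalence of additive categories Z/[P] ≃ T/S. -/

import Mathlib

open CategoryTheory Limits Pretriangulated ZeroObject

namespace IY

variable {T : Type*} [Category T] [Preadditive T] [HasZeroObject T] [HasShift T ℤ]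
  [∀ n : ℤ, (shiftFunctor T n).Additive] [Pretriangulated T]

/-- Right Hom-orthogonal: `A^⊥`. -/
def rightPerp (A : Set T) : Set T := {Y | ∀ X ∈ A, ∀ f : X ⟶ Y, f = 0}

/-- Left Hom-orthogonal: `^⊥B`. -/
def leftPerp (B : Set T) : Set T := {X | ∀ Y ∈ B, ∀ f : X ⟶ Y, f = 0}

/-- The shift `A[n]` of a class of objects. -/
def shiftSet (A : Set T) (n : ℤ) : Set T := (fun X => (X⟦n⟧ : T)) '' A

/-- `Hom(A, B) = 0`. -/
def homOrth (A B : Set T) : Prop := ∀ X ∈ A, ∀ Y ∈ B, ∀ f : X ⟶ Y, f = 0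

/-- `A * B`: objects `E` admitting a distinguished triangle `A → E → B → A[1]`
with `A ∈ A`, `B ∈ B`. -/
def starSet (A B : Set T) : Set T :=
  {E | ∃ (a b : T) (_ : a ∈ A) (_ : b ∈ B) (f : a ⟶ E) (g : E ⟶ b)
    (h : b ⟶ a⟦(1 : ℤ)⟧), Triangle.mk f g h ∈ distTriang T}

/-- A torsion pair `S = A ⊥ B` on the class of objects `S`:
`S = A * B`, `Hom(A,B) = 0`, `A = ^⊥B ∩ S` and `B = A^⊥ ∩ S`. -/
structure IsTorsionPair (S A B : Set T) : Prop where
  subA : A ⊆ S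
  subB : B ⊆ S
  orth : homOrth A B
  ext : S ⊆ starSet A B
  eqA : A = leftPerp B ∩ S
  eqB : B = rightPerp A ∩ S

/-- A thick subcategory: closed under isomorphisms, shifts, extensions (cones) and
direct summands (retracts), and contains the zero object. -/
structure IsThick (S : Set T) : Prop where
  zero : (0 : T) ∈ S
  iso : ∀ ⦃X Y : T⦄, (X ≅ Y) → X ∈ S → Y ∈ S
  shift : ∀ X ∈ S, ∀ n : ℤ, (X⟦n⟧ : T) ∈ S
  ext₂ : ∀ Tr : Triangle T, Tr ∈ (distTriang T) → Tr.obj₁ ∈ S → Tr.obj₃ ∈ S → Tr.obj₂ ∈ S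
  retract : ∀ ⦃X Y : T⦄ (i : X ⟶ Y) (r : Y ⟶ X), i ≫ r = 𝟙 X → Y ∈ S → X ∈ S

/-- The class of morphisms whose cone lies in `S`; the Verdier quotient `T/S` is the
localization of `T` at this class. -/
def qis (S : Set T) : MorphismProperty T := fun X Y f =>
  ∃ (Z : T) (g : Y ⟶ Z) (h : Z ⟶ X⟦(1 : ℤ)⟧),
    Triangle.mk f g h ∈ (distTriang T) ∧ Z ∈ S

/-- A morphism factors through an object of `P`. -/
def factorsThrough (P : Set T) {M N : T} (f : M ⟶ N) : Prop :=
  ∃ (P₀ : T) (_ : P₀ ∈ P) (g : M ⟶ P₀) (h : P₀ ⟶ N), g ≫ h = f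



section Helpers

theorem cy2 {A B C D : T} {f : A ⟶ B} {g : B ⟶ C} {h : C ⟶ A⟦(1 : ℤ)⟧}
    (H : Triangle.mk f g h ∈ distTriang T) (a : D ⟶ B) (ha : a ≫ g = 0) :
    ∃ b : D ⟶ A, a = b ≫ f := Triangle.coyoneda_exact₂ _ H a ha

theorem cy3 {A B C D : T} {f : A ⟶ B} {g : B ⟶ C} {h : C ⟶ A⟦(1 : ℤ)⟧}
    (H : Triangle.mk f g h ∈ distTriang T) (a : D ⟶ C) (ha : a ≫ h = 0) :
    ∃ b : D ⟶ B, a = b ≫ g := Triangle.coyoneda_exact₃ _ H a ha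

theorem yo2 {A B C D : T} {f : A ⟶ B} {g : B ⟶ C} {h : C ⟶ A⟦(1 : ℤ)⟧}
    (H : Triangle.mk f g h ∈ distTriang T) (a : B ⟶ D) (ha : f ≫ a = 0) :
    ∃ b : C ⟶ D, a = g ≫ b := Triangle.yoneda_exact₂ _ H a ha

theorem z12 {A B C : T} {f : A ⟶ B} {g : B ⟶ C} {h : C ⟶ A⟦(1 : ℤ)⟧}
    (H : Triangle.mk f g h ∈ distTriang T) : f ≫ g = 0 := comp_distTriang_mor_zero₁₂ _ H

theorem z23 {A B C : T} {f : A ⟶ B} {g : B ⟶ C} {h : C ⟶ A⟦(1 : ℤ)⟧}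
    (H : Triangle.mk f g h ∈ distTriang T) : g ≫ h = 0 := comp_distTriang_mor_zero₂₃ _ H

theorem rot' {A B C : T} {f : A ⟶ B} {g : B ⟶ C} {h : C ⟶ A⟦(1 : ℤ)⟧}
    (H : Triangle.mk f g h ∈ distTriang T) :
    Triangle.mk g h (-f⟦(1 : ℤ)⟧') ∈ distTriang T := rot_of_distTriang _ H

theorem comp1 {A B C A' B' C' : T} {f : A ⟶ B} {g : B ⟶ C} {h : C ⟶ A⟦(1 : ℤ)⟧}
    {f' : A' ⟶ B'} {g' : B' ⟶ C'} {h' : C' ⟶ A'⟦(1 : ℤ)⟧}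
    (H : Triangle.mk f g h ∈ distTriang T) (H' : Triangle.mk f' g' h' ∈ distTriang T)
    (b : B ⟶ B') (c : C ⟶ C') (hbc : g ≫ c = b ≫ g') : ∃ a : A ⟶ A', f ≫ b = a ≫ f' := by
  obtain ⟨a, ha, -⟩ := complete_distinguished_triangle_morphism₁ _ _ H H' b c hbc
  exact ⟨a, ha⟩

theorem comp2 {A B C A' B' C' : T} {f : A ⟶ B} {g : B ⟶ C} {h : C ⟶ A⟦(1 : ℤ)⟧}
    {f' : A' ⟶ B'} {g' : B' ⟶ C'} {h' : C' ⟶ A'⟦(1 : ℤ)⟧}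
    (H : Triangle.mk f g h ∈ distTriang T) (H' : Triangle.mk f' g' h' ∈ distTriang T)
    (a : A ⟶ A') (c : C ⟶ C') (hac : h ≫ a⟦(1 : ℤ)⟧' = c ≫ h') :
    ∃ b : B ⟶ B', f ≫ b = a ≫ f' ∧ g ≫ c = b ≫ g' :=
  complete_distinguished_triangle_morphism₂ _ _ H H' a c hac

/-- A map killed by `f` factors through `C[-1]`. -/
theorem cy1 {A B C D : T} {f : A ⟶ B} {g : B ⟶ C} {h : C ⟶ A⟦(1 : ℤ)⟧}
    (H : Triangle.mk f g h ∈ distTriang T) (a : D ⟶ A) (ha : a ≫ f = 0) :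
    ∃ (b : D ⟶ C⟦(-1 : ℤ)⟧) (i : (C⟦(-1 : ℤ)⟧ : T) ⟶ A), a = b ≫ i := by
  obtain ⟨b, hb⟩ := Triangle.coyoneda_exact₂ _ (inv_rot_of_distTriang _ H) a ha
  exact ⟨b, _, hb⟩

theorem iso_dist {A B C C' : T} {f : A ⟶ B} {g : B ⟶ C} {h : C ⟶ A⟦(1 : ℤ)⟧}
    (H : Triangle.mk f g h ∈ distTriang T) (e : C ≅ C') :
    Triangle.mk f (g ≫ e.hom) (e.inv ≫ h) ∈ distTriang T := by
  have e1 : f ≫ 𝟙 B = 𝟙 A ≫ f := by simp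
  have e2 : (g ≫ e.hom) ≫ e.inv = 𝟙 B ≫ g := by simp
  have e3 : (e.inv ≫ h) ≫ (𝟙 A)⟦(1 : ℤ)⟧' = e.inv ≫ h := by simp
  exact isomorphic_distinguished _ H _
    (Triangle.isoMk _ _ (Iso.refl _) (Iso.refl _) e.symm e1 e2 e3)

theorem shift_hom_zero {A B : T} (h : ∀ f : A ⟶ B, f = 0)
    (g : (A⟦(1 : ℤ)⟧ : T) ⟶ B⟦(1 : ℤ)⟧) : g = 0 := by
  obtain ⟨f, rfl⟩ := (shiftFunctor T (1 : ℤ)).map_surjective g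
  rw [h f, Functor.map_zero]

/-- If `C[-1]` lies in `A * B`, then there is a triangle `b → a[1] → C → b[1]`. -/
theorem star_shift {A B : Set T} {C : T} (h : (C⟦(-1 : ℤ)⟧ : T) ∈ starSet A B) :
    ∃ (a b : T) (_ : a ∈ A) (_ : b ∈ B) (f : b ⟶ a⟦(1 : ℤ)⟧) (g : (a⟦(1 : ℤ)⟧ : T) ⟶ C)
      (h : C ⟶ b⟦(1 : ℤ)⟧), Triangle.mk f g h ∈ distTriang T := by
  obtain ⟨a, b, ha, hb, f, g, h, H⟩ := h
  have H2 := rot' (rot' H)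
  let e : ((C⟦(-1 : ℤ)⟧ : T)⟦(1 : ℤ)⟧ : T) ≅ C := (shiftEquiv T (1 : ℤ)).counitIso.app C
  exact ⟨a, b, ha, hb, _, _, _, iso_dist H2 e⟩

end Helpers

section Quot

variable {S : Set T}

theorem S_cone (hS : IsThick S) {A B C : T} {f : A ⟶ B} {g : B ⟶ C} {h : C ⟶ A⟦(1 : ℤ)⟧}
    (H : Triangle.mk f g h ∈ distTriang T) (hA : A ∈ S) (hB : B ∈ S) : C ∈ S :=
  hS.ext₂ _ (rot' H) hB (hS.shift _ hA 1)

theorem S_mid (hS : IsThick S) {A B C : T} {f : A ⟶ B} {g : B ⟶ C} {h : C ⟶ A⟦(1 : ℤ)⟧}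
    (H : Triangle.mk f g h ∈ distTriang T) (hA : A ∈ S) (hC : C ∈ S) : B ∈ S :=
  hS.ext₂ _ H hA hC

theorem S_left (hS : IsThick S) {A B C : T} {f : A ⟶ B} {g : B ⟶ C} {h : C ⟶ A⟦(1 : ℤ)⟧}
    (H : Triangle.mk f g h ∈ distTriang T) (hB : B ∈ S) (hC : C ∈ S) : A ∈ S :=
  hS.ext₂ _ (inv_rot_of_distTriang _ H) (hS.shift _ hC (-1)) hB

theorem qis_of_left (hS : IsThick S) {A B C : T} {f : A ⟶ B} {g : B ⟶ C} {h : C ⟶ A⟦(1 : ℤ)⟧}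
    (H : Triangle.mk f g h ∈ distTriang T) (hA : A ∈ S) : qis S g :=
  ⟨_, _, _, rot' H, hS.shift _ hA 1⟩

theorem factors_add (hS : IsThick S) {A B : T} {f g : A ⟶ B} (hf : factorsThrough S f)
    (hg : factorsThrough S g) : factorsThrough S (f + g) := by
  obtain ⟨D, hD, a, b, rfl⟩ := hf
  obtain ⟨E, hE, c, d, rfl⟩ := hg
  refine ⟨D ⊞ E, hS.ext₂ _ (binaryBiproductTriangle_distinguished D E) hD hE,
    biprod.lift a c, biprod.desc b d, by simp⟩

theorem qis_cancel (hS : IsThick S) {A B M : T} (s : A ⟶ B) (hs : qis S s) (g : M ⟶ A)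
    (h : factorsThrough S (g ≫ s)) : factorsThrough S g := by
  obtain ⟨C, k, l, H, hC⟩ := hs
  obtain ⟨D, hD, d, w, hdw⟩ := h
  obtain ⟨E, p, r, HE⟩ := distinguished_cocone_triangle₁ (w ≫ k)
  obtain ⟨q, hq⟩ := comp1 HE H w (𝟙 C) (Category.comp_id _)
  obtain ⟨e, he⟩ := cy2 HE d (by rw [← Category.assoc, hdw, Category.assoc, z12 H, comp_zero])
  have h0 : (g - e ≫ q) ≫ s = 0 := by
    rw [Preadditive.sub_comp, Category.assoc, ← hq, ← hdw, he, Category.assoc, sub_self]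
  obtain ⟨u, _, hu⟩ := cy1 H (g - e ≫ q) h0
  have h1 : factorsThrough S (g - e ≫ q) := ⟨_, hS.shift _ hC (-1), u, _, hu.symm⟩
  have h2 : factorsThrough S (e ≫ q) := ⟨E, S_left hS HE hD hC, e, q, rfl⟩
  simpa using factors_add hS h1 h2

theorem ore_single (hS : IsThick S) {A B D : T} (s : A ⟶ B) (hs : qis S s) (f : A ⟶ D) :
    ∃ (E : T) (t : D ⟶ E) (g : B ⟶ E), qis S t ∧ f ≫ t = s ≫ g := by
  obtain ⟨C, k, l, H, hC⟩ := hs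
  obtain ⟨E, t, m, HE⟩ := distinguished_cocone_triangle₂ (l ≫ f⟦(1 : ℤ)⟧')
  obtain ⟨b, hb, -⟩ := comp2 H HE f (𝟙 C)
    (Category.id_comp _).symm
  exact ⟨E, t, b, ⟨_, _, _, HE, hC⟩, hb.symm⟩

theorem factors_kill (hS : IsThick S) {A B : T} {f : A ⟶ B} (hf : factorsThrough S f) :
    ∃ (E : T) (t : B ⟶ E), qis S t ∧ f ≫ t = 0 := by
  obtain ⟨D, hD, a, b, rfl⟩ := hf
  obtain ⟨E, t, l, H⟩ := distinguished_cocone_triangle b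
  exact ⟨E, t, qis_of_left hS H hD, by rw [Category.assoc, z12 H, comp_zero]⟩

theorem ext_single (hS : IsThick S) {A B D : T} (s : A ⟶ B) (hs : qis S s) (f g : B ⟶ D)
    (h : s ≫ f = s ≫ g) : ∃ (E : T) (t : D ⟶ E), qis S t ∧ f ≫ t = g ≫ t := by
  obtain ⟨C, k, l, H, hC⟩ := hs
  obtain ⟨u, hu⟩ := yo2 H (f - g) (by rw [Preadditive.comp_sub, h, sub_self])
  obtain ⟨E, t, ht, h0⟩ := factors_kill hS (f := f - g) ⟨C, hC, k, u, hu.symm⟩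
  exact ⟨E, t, ht, by rwa [Preadditive.sub_comp, sub_eq_zero] at h0⟩

theorem ore_W (hS : IsThick S) {A B : T} (s : A ⟶ B) (hs : (qis S).multiplicativeClosure s) :
    ∀ {D : T} (f : A ⟶ D), ∃ (E : T) (t : D ⟶ E) (g : B ⟶ E),
      (qis S).multiplicativeClosure t ∧ f ≫ t = s ≫ g := by
  induction hs with
  | of s hs =>
    intro D f
    obtain ⟨E, t, g, ht, h⟩ := ore_single hS s hs f
    exact ⟨E, t, g, .of _ ht, h⟩
  | id A => intro D f; exact ⟨D, 𝟙 D, f, .id _, by simp⟩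
  | comp_of s s' hs hs' ih =>
    intro D f
    obtain ⟨E, t, g, ht, h⟩ := ih f
    obtain ⟨E', t', g', ht', h'⟩ := ore_single hS s' hs' g
    exact ⟨E', t ≫ t', g', .comp_of _ _ ht ht', by
      rw [← Category.assoc, h, Category.assoc, h', Category.assoc]⟩

theorem ext_W (hS : IsThick S) {A B : T} (s : A ⟶ B) (hs : (qis S).multiplicativeClosure s) :
    ∀ {D : T} (f g : B ⟶ D) (_ : s ≫ f = s ≫ g), ∃ (E : T) (t : D ⟶ E),
      (qis S).multiplicativeClosure t ∧ f ≫ t = g ≫ t := by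
  induction hs with
  | of s hs =>
    intro D f g h
    obtain ⟨E, t, ht, h⟩ := ext_single hS s hs f g h
    exact ⟨E, t, .of _ ht, h⟩
  | id A => intro D f g h; exact ⟨D, 𝟙 D, .id _, by simpa using h⟩
  | comp_of s s' hs hs' ih =>
    intro D f g h
    obtain ⟨E, t, ht, h⟩ := ih (s' ≫ f) (s' ≫ g) (by simpa using h)
    obtain ⟨E', t', ht', h'⟩ := ext_single hS s' hs' (f ≫ t) (g ≫ t) (by simpa using h)
    exact ⟨E', t ≫ t', .comp_of _ _ ht ht', by simpa using h'⟩

theorem left_calc (hS : IsThick S) : (qis S).multiplicativeClosure.HasLeftCalculusOfFractions where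
  exists_leftFraction A B φ := by
    obtain ⟨E, t, g, ht, h⟩ := ore_W hS φ.s φ.hs φ.f
    exact ⟨⟨g, t, ht⟩, h⟩
  ext A B D f g s hs h := by
    obtain ⟨E, t, ht, h⟩ := ext_W hS s hs f g h
    exact ⟨E, t, ht, h⟩

theorem W_cancel (hS : IsThick S) {A B : T} (s : A ⟶ B) (hs : (qis S).multiplicativeClosure s) :
    ∀ {M : T} (g : M ⟶ A) (_ : factorsThrough S (g ≫ s)), factorsThrough S g := by
  induction hs with
  | of s hs => intro M g h; exact qis_cancel hS s hs g h
  | id A => intro M g h; simpa using h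
  | comp_of s s' hs hs' ih =>
    intro M g h
    exact ih g (qis_cancel hS s' hs' (g ≫ s) (by simpa using h))

end Quot

section Loc

variable {U : Type*} [Category U] {S : Set T} (Q : T ⥤ U) [Q.IsLocalization (qis S)]

theorem loc_W : Q.IsLocalization (qis S).multiplicativeClosure := by
  refine Functor.IsLocalization.of_equivalence_source Q (qis S) Q _ CategoryTheory.Equivalence.refl ?_ ?_
    (Functor.leftUnitor Q)
  · intro A B f hf
    exact MorphismProperty.le_isoClosure _ _ (.of _ hf)
  · intro A B f hf
    induction hf with
    | of s hs => exact Localization.inverts Q (qis S) s hs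
    | id A => infer_instance
    | comp_of s s' hs hs' ih =>
      have := Localization.inverts Q (qis S) s' hs'
      rw [Q.map_comp]
      infer_instance

theorem map_eq_iff_factors (hS : IsThick S) {A B : T} (f g : A ⟶ B) :
    Q.map f = Q.map g ↔ factorsThrough S (f - g) := by
  constructor
  · intro h
    have := left_calc hS
    have := loc_W (S := S) Q
    obtain ⟨Z, s, hs, h⟩ := (MorphismProperty.map_eq_iff_postcomp Q
      (qis S).multiplicativeClosure f g).1 h
    refine W_cancel hS s hs _ ⟨0, hS.zero, 0, 0, ?_⟩
    rw [Preadditive.sub_comp, h, sub_self, zero_comp]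
  · intro h
    obtain ⟨E, t, ht, h0⟩ := factors_kill hS h
    rw [Preadditive.sub_comp, sub_eq_zero] at h0
    have := Localization.inverts Q (qis S) t ht
    rw [← cancel_mono (Q.map t), ← Q.map_comp, h0, Q.map_comp]

variable {X Y : Set T}

theorem S_tors (hS : IsThick S) (h1 : IsTorsionPair S X Y) {C : T} (hC : C ∈ S) :
    ∃ (a b : T) (_ : a ∈ X) (_ : b ∈ Y) (f : b ⟶ a⟦(1 : ℤ)⟧) (g : (a⟦(1 : ℤ)⟧ : T) ⟶ C)
      (h : C ⟶ b⟦(1 : ℤ)⟧), Triangle.mk f g h ∈ distTriang T :=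
  star_shift (h1.ext (hS.shift _ hC (-1)))

/-- On `Z`, factoring through `S` is the same as factoring through `P`. -/
theorem factors_P (hS : IsThick S) (h1 : IsTorsionPair S X Y) {M N : T} (hM : M ∈ leftPerp (shiftSet Y 1)) (hN : N ∈ rightPerp X)
    {f : M ⟶ N} (h : factorsThrough S f) : factorsThrough (shiftSet X 1 ∩ Y) f := by
  obtain ⟨C, hC, a, b, rfl⟩ := h
  obtain ⟨x, y, hx, hy, i, p, l, H⟩ := h1.ext hC
  obtain ⟨c, hc⟩ := yo2 H b (hN x hx _)
  obtain ⟨x', y', hx', hy', j, q, r, H'⟩ := S_tors hS h1 (h1.subB hy)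
  obtain ⟨d, hd⟩ := cy3 H' (a ≫ p) (hM _ ⟨y', hy', rfl⟩ _)
  refine ⟨x'⟦(1 : ℤ)⟧, ⟨⟨x', hx', rfl⟩, ?_⟩, d, q ≫ c, ?_⟩
  · rw [h1.eqB]
    refine ⟨fun z hz g => ?_, hS.shift _ (h1.subA hx') 1⟩
    obtain ⟨k, hk⟩ := cy2 H' g (h1.orth z hz y hy _)
    rw [hk, h1.orth z hz y' hy' k, zero_comp]
  · rw [hc, ← Category.assoc, ← hd, Category.assoc]

/-- Lifting along a single quasi-isomorphism out of an object of `X^⊥`. -/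
theorem lift_single (hS : IsThick S) (h1 : IsTorsionPair S X Y) {M A B : T} (hM : M ∈ leftPerp (shiftSet Y 1)) (hA : A ∈ rightPerp X)
    (s : A ⟶ B) (hs : qis S s) (a : M ⟶ B) : ∃ f : M ⟶ A, factorsThrough S (a - f ≫ s) := by
  obtain ⟨C, k, l, H, hC⟩ := hs
  obtain ⟨x, y, hx, hy, i, p, r, H'⟩ := S_tors hS h1 hC
  obtain ⟨u, hu⟩ := cy3 H p (shift_hom_zero (hA x hx) _)
  obtain ⟨v, hv⟩ := cy3 H' (a ≫ k) (hM _ ⟨y, hy, rfl⟩ _)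
  obtain ⟨f, hf⟩ := cy2 H (a - v ≫ u) (by
    rw [Preadditive.sub_comp, hv, hu, Category.assoc, sub_self])
  refine ⟨f, _, hS.shift _ (h1.subA hx) 1, v, u, ?_⟩
  rw [← hf]; abel

theorem one_step (hS : IsThick S) (h1 : IsTorsionPair S X Y) {M A B A' B' x : T} (hM : M ∈ leftPerp (shiftSet Y 1))
    (s : A ⟶ B) (hs : qis S s) (t : A ⟶ A') (hA' : A' ∈ rightPerp X) (hx : x ∈ X)
    (i : x ⟶ B) (t' : B ⟶ B') (j : B' ⟶ x⟦(1 : ℤ)⟧)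
    (H' : Triangle.mk i t' j ∈ distTriang T) (m : M ⟶ B') (φ : Q.obj M ⟶ Q.obj A)
    (hφ : φ ≫ Q.map s ≫ Q.map t' = Q.map m) : ∃ f : M ⟶ A', Q.map f = φ ≫ Q.map t := by
  obtain ⟨C, k, l, H, hC⟩ := hs
  obtain ⟨C', c, d, HC⟩ := distinguished_cocone_triangle (i ≫ k)
  have hC' : C' ∈ S := S_cone hS HC (h1.subA hx) hC
  obtain ⟨e, he⟩ := yo2 HC (l ≫ t⟦(1 : ℤ)⟧') (by
    rw [Category.assoc, ← Category.assoc k, z23 H, zero_comp, comp_zero])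
  obtain ⟨B'', s'', k'', H''⟩ := distinguished_cocone_triangle₂ e
  obtain ⟨β, hβ1, hβ2⟩ := comp2 H H'' t c he
  obtain ⟨w, hw⟩ := cy2 H'' (i ≫ β) (by
    rw [Category.assoc, ← hβ2, ← Category.assoc, z12 HC])
  obtain ⟨γ, hγ⟩ := yo2 H' β (by rw [hw, hA' x hx w, zero_comp])
  have hs'' : qis S s'' := ⟨_, _, _, H'', hC'⟩
  obtain ⟨f, hf⟩ := lift_single hS h1 hM hA' s'' hs'' (m ≫ γ)
  have hf' := (map_eq_iff_factors Q hS _ _).2 hf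
  have := Localization.inverts Q (qis S) s'' hs''
  refine ⟨f, ?_⟩
  rw [← cancel_mono (Q.map s''), ← Q.map_comp, ← hf', Q.map_comp, ← hφ]
  simp only [Category.assoc, ← Q.map_comp]
  rw [← hγ, hβ1]

theorem full_W (hS : IsThick S) (h1 : IsTorsionPair S X Y) (h2 : IsTorsionPair Set.univ X (rightPerp X)) {M A B : T}
    (hM : M ∈ leftPerp (shiftSet Y 1)) (s : A ⟶ B)
    (hs : (qis S).multiplicativeClosure' s) :
    ∀ {A' : T} (t : A ⟶ A') (_ : A' ∈ rightPerp X) (a : M ⟶ B) (φ : Q.obj M ⟶ Q.obj A)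
      (_ : φ ≫ Q.map s = Q.map a), ∃ f : M ⟶ A', Q.map f = φ ≫ Q.map t := by
  induction hs with
  | @of A B s hs =>
    intro A' t hA' a φ hφ
    obtain ⟨x, B', hx, hB', i, t', j, H'⟩ := h2.ext (Set.mem_univ B)
    refine one_step Q hS h1 hM s hs t hA' hx i t' j H' (a ≫ t') φ ?_
    rw [Q.map_comp, ← hφ, Category.assoc]
  | id A =>
    intro A' t hA' a φ hφ
    refine ⟨a ≫ t, ?_⟩
    rw [Q.map_comp, ← hφ]; simp
  | @of_comp A B D s s' hs hs' ih =>
    intro A' t hA' a φ hφ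
    obtain ⟨x, B', hx, hB', i, t', j, H'⟩ := h2.ext (Set.mem_univ B)
    obtain ⟨m, hm⟩ := ih t' hB' a (φ ≫ Q.map s) (by rw [← hφ]; simp)
    exact one_step Q hS h1 hM s hs t hA' hx i t' j H' m φ (by rw [hm, Category.assoc])

end Loc

/-- For `M, N ∈ Z = X^⊥ ∩ ^⊥(Y[1])`, the natural map
`Hom_T(M,N)/[P](M,N) → Hom_{T/S}(M,N)` is bijective (the quotient functor is full on `Z`,
and two morphisms have the same image iff their difference factors through
`P = X[1] ∩ Y`); moreover every object of `T/S` is isomorphic to the image of an object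
of `Z`, so `Z/[P] ≃ T/S` as additive categories. -/
theorem stmt2 {U : Type*} [Category U] (S X Y : Set T) (Q : T ⥤ U)
    [Q.IsLocalization (qis S)] (hS : IsThick S)
    (h1 : IsTorsionPair S X Y)
    (h2 : IsTorsionPair Set.univ X (rightPerp X))
    (h3 : IsTorsionPair Set.univ (leftPerp Y) Y) :
    (∀ M ∈ rightPerp X ∩ leftPerp (shiftSet Y 1),
     ∀ N ∈ rightPerp X ∩ leftPerp (shiftSet Y 1),
      (∀ φ : Q.obj M ⟶ Q.obj N, ∃ f : M ⟶ N, Q.map f = φ) ∧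
      (∀ f g : M ⟶ N, Q.map f = Q.map g ↔ factorsThrough (shiftSet X 1 ∩ Y) (f - g))) ∧
    (∀ A : U, ∃ Z₀ ∈ rightPerp X ∩ leftPerp (shiftSet Y 1), Nonempty (A ≅ Q.obj Z₀)) := by
  refine ⟨fun M hM N hN => ⟨fun φ => ?_, fun f g => ?_⟩, fun A => ?_⟩
  · have := left_calc hS
    have := loc_W (S := S) Q
    obtain ⟨ψ, hψ⟩ := Localization.exists_leftFraction Q (qis S).multiplicativeClosure φ
    have hs : (qis S).multiplicativeClosure' ψ.s :=
      (MorphismProperty.multiplicativeClosure_eq_multiplicativeClosure' (qis S)).le _ ψ.hs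
    obtain ⟨f, hf⟩ := full_W Q hS h1 h2 hM.2 ψ.s hs (𝟙 N) hN.1 ψ.f φ (by rw [hψ]; simp)
    exact ⟨f, by simpa using hf⟩
  · rw [map_eq_iff_factors Q hS]
    constructor
    · exact factors_P hS h1 hM.2 hN.1
    · rintro ⟨P, hP, a, b, h⟩
      exact ⟨P, h1.subB hP.2, a, b, h⟩
  · have := Localization.essSurj Q (qis S)
    obtain ⟨x, A', hx, hA', i, t, j, H⟩ := h2.ext (Set.mem_univ (Q.objPreimage A))
    obtain ⟨l, y, hl, hy, p, q, r, H'⟩ := star_shift (h3.ext (Set.mem_univ (A'⟦(-1 : ℤ)⟧)))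
    have i1 := Localization.inverts Q (qis S) t (qis_of_left hS H (h1.subA hx))
    have i2 := Localization.inverts Q (qis S) q (qis_of_left hS H' (h1.subB hy))
    refine ⟨l⟦(1 : ℤ)⟧, ⟨fun z hz g => ?_, ?_⟩,
      ⟨(Q.objObjPreimageIso A).symm ≪≫ asIso (Q.map t) ≪≫ (asIso (Q.map q)).symm⟩⟩
    · obtain ⟨k, hk⟩ := cy2 H' g (hA' z hz _)
      rw [hk, h1.orth z hz y hy k, zero_comp]
    · rintro _ ⟨y', hy', rfl⟩ g
      exact shift_hom_zero (hl y' hy') g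


end IY
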